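/- Let n ≥ 1 and let m be a positive integer. Then, as an identity of rational functions in ℚ(x_1,…,x_n), the Schur polynomial s_{(m^{n−1})} in the 2n−1 variables (x_1, x_1^{−1}, …, x_{n−1}, x_{n−1}^{−1}, x_n) equals the sum of the intermediate symplectic characters sp^{(n−1,1)}_λ(x_1,…,x_{n−1} | x_n) over all λ ∈ Odd′((m^n)) if n is even, and over all λ ∈ Even′((m^n)) if n is odd. -/

import Mathlib

open Matrix BigOperators
open scoped Classical

noncomputable section

/-- The field `ℚ(t_1, …, t_n)` of rational functions in `n` indeterminates over `ℚ`. -/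
abbrev FF (n : ℕ) : Type := FractionRing (MvPolynomial (Fin n) ℚ)

/-- The `i`-th indeterminate, viewed as an element of `FF n`. -/
def gen (n : ℕ) (i : Fin n) : FF n :=
  algebraMap (MvPolynomial (Fin n) ℚ) (FF n) (MvPolynomial.X i)

variable {F : Type*} [Field F]

/-- Symplectic character `sp_λ(z_1, …, z_N)` for an integer weight `μ`. -/
def spP {N : ℕ} (z : Fin N → F) (μ : Fin N → ℤ) : F :=
  Matrix.det (Matrix.of fun i j : Fin N =>
      z j ^ (μ i + (N : ℤ) - (i : ℕ)) - z j ^ (-(μ i + (N : ℤ) - (i : ℕ)))) /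
  Matrix.det (Matrix.of fun i j : Fin N =>
      z j ^ ((N : ℤ) - (i : ℕ)) - z j ^ (-((N : ℤ) - (i : ℕ))))

/-- The matrix `Ā_λ` of the bialternant formula for the intermediate symplectic character
`sp^{(k, N-k)}` with integer weight `μ`. -/
def interMatP {N : ℕ} (k : ℕ) (z : Fin N → F) (μ : Fin N → ℤ) : Matrix (Fin N) (Fin N) F :=
  Matrix.of fun i j : Fin N =>
    if (j : ℕ) < k then
      z j ^ (μ i + (k : ℤ) - (i : ℕ)) /
          ∏ l ∈ Finset.univ.filter (fun l : Fin N => k ≤ (l : ℕ)), (1 - (z j)⁻¹ * z l) -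
        z j ^ (-(μ i + (k : ℤ) - (i : ℕ))) /
          ∏ l ∈ Finset.univ.filter (fun l : Fin N => k ≤ (l : ℕ)), (1 - z j * z l)
    else z j ^ (μ i + (N : ℤ) - 1 - (i : ℕ))

/-- Intermediate symplectic character `sp^{(k, N-k)}_μ(z_1, …, z_k | z_{k+1}, …, z_N)`
for an integer weight `μ`. -/
def spInterP {N : ℕ} (k : ℕ) (z : Fin N → F) (μ : Fin N → ℤ) : F :=
  (interMatP k z μ).det / (interMatP k z fun _ => 0).det

/-- Schur function `s_μ(z_1, …, z_N)` as a ratio of alternants (bialternant formula). -/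
def schurP {N : ℕ} (z : Fin N → F) (μ : Fin N → ℤ) : F :=
  Matrix.det (Matrix.of fun i j : Fin N => z j ^ (μ i + (N : ℤ) - 1 - (i : ℕ))) /
  Matrix.det (Matrix.of fun i j : Fin N => z j ^ ((N : ℤ) - 1 - (i : ℕ)))

section Interpolation

open Polynomial

/-- A partial-fraction identity, obtained by Lagrange interpolation at the nodes `S ∪ {1, -1}`. -/
theorem sum_linear_mul_prod_div (h2 : (2 : F) ≠ 0) (S : Finset F) (hS : ∀ z ∈ S, z ^ 2 ≠ 1)
    (a b : F) :
    ∑ z ∈ S, (a * z + b) * ∏ w ∈ S.erase z, (z * w - 1) / (z - w) =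
      a * ∏ z ∈ S, z - ((a + b) * (-1) ^ S.card + a - b) / 2 := by
  have hne : (1 : F) ≠ -1 := by
    intro h
    apply h2
    linear_combination h
  have h1 : (1 : F) ∉ insert (-1 : F) S := by
    simp only [Finset.mem_insert, not_or]
    exact ⟨hne, fun h => hS _ h (by ring)⟩
  have h1S : (1 : F) ∉ S := fun h => hS _ h (by ring)
  have hm1 : (-1 : F) ∉ S := fun h => hS _ h (by ring)
  have hcard : (insert (1 : F) (insert (-1 : F) S)).card = S.card + 2 := by
    rw [Finset.card_insert_of_notMem h1, Finset.card_insert_of_notMem hm1]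
  set Q : F[X] := ∏ w ∈ S, (C w * X - 1) with hQ
  have hQdeg : Q.natDegree ≤ S.card := by
    refine (natDegree_prod_le _ _).trans ?_
    calc _ ≤ ∑ w ∈ S, 1 := by
          refine Finset.sum_le_sum fun w _ => ?_
          compute_degree
      _ = _ := by simp
  have hQc : Q.coeff S.card = ∏ z ∈ S, z := by
    have := coeff_prod_of_natDegree_le (s := S) (fun w : F => C w * X - 1) 1
      (fun w _ => by compute_degree)
    rw [mul_one] at this
    rw [hQ, this]
    refine Finset.prod_congr rfl fun w _ => ?_
    simp [coeff_one]
  have hPdeg : ((C a * X + C b) * Q).natDegree ≤ S.card + 1 := by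
    refine natDegree_mul_le.trans ?_
    have : (C a * X + C b).natDegree ≤ 1 := by compute_degree
    omega
  have key := Lagrange.coeff_eq_sum (s := insert (1 : F) (insert (-1 : F) S)) (v := id)
    (P := (C a * X + C b) * Q) Function.injective_id.injOn
    (by
      rw [hcard]
      refine lt_of_le_of_lt degree_le_natDegree ?_
      exact_mod_cast Nat.lt_succ_of_le hPdeg)
  rw [hcard, Finset.sum_insert h1, Finset.sum_insert hm1] at key
  have hcoeff : ((C a * X + C b) * Q).coeff (S.card + 2 - 1) = a * ∏ z ∈ S, z := by
    have : Q.coeff (S.card + 1) = 0 := coeff_eq_zero_of_natDegree_lt (by omega)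
    rw [add_mul, coeff_add, show S.card + 2 - 1 = S.card + 1 by omega, mul_assoc, coeff_C_mul,
      coeff_C_mul, coeff_X_mul, this, hQc]
    ring
  have hev : ∀ u : F, ((C a * X + C b) * Q).eval u = (a * u + b) * ∏ w ∈ S, (w * u - 1) := by
    intro u
    simp [hQ, eval_prod]
  rw [hcoeff] at key
  simp only [hev, id] at key
  have e1 : (insert (1 : F) (insert (-1 : F) S)).erase 1 = insert (-1 : F) S :=
    Finset.erase_insert h1
  have e2 : (insert (1 : F) (insert (-1 : F) S)).erase (-1) = insert (1 : F) S := by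
    rw [Finset.insert_comm]
    exact Finset.erase_insert (by simp only [Finset.mem_insert, not_or]; exact ⟨hne.symm, hm1⟩)
  have hz : ∀ z ∈ S, (a * z + b) * (∏ w ∈ S, (w * z - 1)) /
      ∏ j ∈ (insert (1 : F) (insert (-1 : F) S)).erase z, (z - j) =
      (a * z + b) * ∏ w ∈ S.erase z, (z * w - 1) / (z - w) := by
    intro z hzS
    have z1 : z ≠ 1 := fun h => h1S (h ▸ hzS)
    have z2 : z ≠ -1 := fun h => hm1 (h ▸ hzS)
    rw [Finset.erase_insert_of_ne z1.symm, Finset.erase_insert_of_ne z2.symm,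
      Finset.prod_insert (by simp [h1S, hne]), Finset.prod_insert (by simp [hm1]),
      ← Finset.mul_prod_erase S _ hzS, Finset.prod_div_distrib]
    have d1 : z - 1 ≠ 0 := sub_ne_zero.mpr z1
    have d2 : z - -1 ≠ 0 := sub_ne_zero.mpr z2
    have d3 : ∏ j ∈ S.erase z, (z - j) ≠ 0 := by
      refine Finset.prod_ne_zero_iff.mpr fun j hj => sub_ne_zero.mpr ?_
      exact (Finset.ne_of_mem_erase hj).symm
    have : ∏ w ∈ S.erase z, (w * z - 1) = ∏ w ∈ S.erase z, (z * w - 1) :=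
      Finset.prod_congr rfl fun w _ => by ring
    rw [this]
    field_simp
    ring
  rw [Finset.sum_congr rfl hz, e1, e2, Finset.prod_insert hm1, Finset.prod_insert h1S] at key
  have p1 : ∏ w ∈ S, (w * 1 - 1) = (-1) ^ S.card * ∏ j ∈ S, (1 - j) := by
    rw [← Finset.prod_const, ← Finset.prod_mul_distrib]
    exact Finset.prod_congr rfl fun w _ => by ring
  have p2 : ∏ w ∈ S, (w * -1 - 1) = ∏ j ∈ S, (-1 - j) :=
    Finset.prod_congr rfl fun w _ => by ring
  have d1 : ∏ j ∈ S, (1 - j) ≠ 0 :=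
    Finset.prod_ne_zero_iff.mpr fun j hj => sub_ne_zero.mpr fun h => h1S (h ▸ hj)
  have d2 : ∏ j ∈ S, (-1 - j) ≠ 0 :=
    Finset.prod_ne_zero_iff.mpr fun j hj => sub_ne_zero.mpr fun h => hm1 (h ▸ hj)
  rw [p1, p2] at key
  rw [eq_sub_iff_add_eq, key, ← add_assoc, add_comm]
  congr 1
  have h3 : (1 : F) - -1 ≠ 0 := sub_ne_zero.mpr hne
  have h4 : (-1 : F) - 1 ≠ 0 := sub_ne_zero.mpr hne.symm
  have h5 : (1 : F) - -1 = 2 := by ring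
  have h6 : (-1 : F) - 1 = - 2 := by ring
  rw [h5, h6]
  field_simp
  ring

end Interpolation

section Laplace

variable {N : ℕ}

/-- The alternant with exponents `0, …, d - 1, e, e + 1, …`. -/
def twoBlockAlternant (d e : ℕ) (z : Fin N → F) : Matrix (Fin N) (Fin N) F :=
  Matrix.of fun i j => if (j : ℕ) < d then z i ^ (j : ℕ) else z i ^ (e + ((j : ℕ) - d))

/-- The contribution of the subset `{i | χ i}` to the Laplace expansion of a two-block alternant,
divided by the Vandermonde determinant. -/
def subsetWeight {ι : Type*} [Fintype ι] (e : ℕ) (z : ι → F) (χ : ι → Bool) : F :=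
  (∏ i, if χ i then z i ^ e else 1) * ∏ i, ∏ j, if χ i ∧ ¬ χ j then (z i - z j)⁻¹ else 1

theorem card_filter_fin_lt {d : ℕ} (hd : d ≤ N) :
    (Finset.univ.filter fun j : Fin N => (j : ℕ) < d).card = d := by
  rw [Fin.card_filter_val_lt]
  omega

/-- Determinants of two matrices which agree up to row scaling, except in a block which no
permutation avoiding the zero block can meet. -/
theorem det_eq_prod_mul_det_of_block {d : ℕ} (χ : Fin N → Bool)
    (hχ : (Finset.univ.filter fun i => χ i = false).card = d) (hd : d ≤ N) (r : Fin N → F)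
    (A B : Matrix (Fin N) (Fin N) F)
    (h0 : ∀ i (j : Fin N), χ i = false → d ≤ (j : ℕ) → A i j = 0 ∧ B i j = 0)
    (h1 : ∀ i (j : Fin N), χ i = false → (j : ℕ) < d → A i j = r i * B i j)
    (h2 : ∀ i (j : Fin N), χ i = true → d ≤ (j : ℕ) → A i j = r i * B i j) :
    A.det = (∏ i, r i) * B.det := by
  rw [Matrix.det_apply', Matrix.det_apply', Finset.mul_sum]
  refine Finset.sum_congr rfl fun σ _ => ?_
  by_cases hσ : ∀ j : Fin N, χ (σ j) = false → (j : ℕ) < d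
  · have hsub : (Finset.univ.filter fun i => χ i = false).image σ.symm ⊆
        Finset.univ.filter fun j : Fin N => (j : ℕ) < d := by
      intro j hj
      simp only [Finset.mem_image, Finset.mem_filter, Finset.mem_univ, true_and] at hj ⊢
      obtain ⟨i, hi, rfl⟩ := hj
      exact hσ _ (by simpa using hi)
    have heq := Finset.eq_of_subset_of_card_le hsub (by
      rw [card_filter_fin_lt hd, Finset.card_image_of_injective _ σ.symm.injective, hχ])
    have hσ' : ∀ j : Fin N, (j : ℕ) < d → χ (σ j) = false := by
      intro j hj
      have : j ∈ Finset.univ.filter fun j : Fin N => (j : ℕ) < d := by simpa using hj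
      rw [← heq] at this
      simp only [Finset.mem_image, Finset.mem_filter, Finset.mem_univ, true_and] at this
      obtain ⟨i, hi, rfl⟩ := this
      simpa using hi
    rw [← Equiv.prod_comp σ r, mul_left_comm, ← Finset.prod_mul_distrib]
    congr 1
    refine Finset.prod_congr rfl fun j _ => ?_
    by_cases hj : (j : ℕ) < d
    · exact h1 _ _ (hσ' j hj) hj
    · refine h2 _ _ ?_ (not_lt.mp hj)
      by_contra hc
      exact hj (hσ j (by simpa using hc))
  · push Not at hσ
    obtain ⟨j, hj1, hj2⟩ := hσ
    rw [Finset.prod_eq_zero (f := fun i => A (σ i) i) (Finset.mem_univ j) (h0 _ _ hj1 hj2).1,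
      Finset.prod_eq_zero (f := fun i => B (σ i) i) (Finset.mem_univ j) (h0 _ _ hj1 hj2).2]
    simp

theorem det_eq_zero_of_block {d : ℕ} (χ : Fin N → Bool)
    (hχ : (Finset.univ.filter fun i => χ i = false).card ≠ d) (hd : d ≤ N)
    (A : Matrix (Fin N) (Fin N) F)
    (h0 : ∀ i (j : Fin N), χ i = false → d ≤ (j : ℕ) → A i j = 0)
    (h1 : ∀ i (j : Fin N), χ i = true → (j : ℕ) < d → A i j = 0) : A.det = 0 := by
  rw [Matrix.det_apply']
  refine Finset.sum_eq_zero fun σ _ => ?_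
  by_cases hσ : ∀ j : Fin N, χ (σ j) = false ↔ (j : ℕ) < d
  · refine absurd ?_ hχ
    rw [← card_filter_fin_lt hd]
    refine (Finset.card_bij (fun j _ => σ j) ?_ (fun _ _ _ _ h => σ.injective h) ?_).symm
    · intro j hj
      simpa [hσ] using hj
    · intro i hi
      refine ⟨σ.symm i, ?_, by simp⟩
      have := hσ (σ.symm i)
      simp only [Equiv.apply_symm_apply] at this
      simpa [← this] using hi
  · push Not at hσ
    obtain ⟨j, hj | hj⟩ := hσ
    · rw [Finset.prod_eq_zero (f := fun i => A (σ i) i) (Finset.mem_univ j) (h0 _ _ hj.1 hj.2)]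
      simp
    · rw [Finset.prod_eq_zero (f := fun i => A (σ i) i) (Finset.mem_univ j) (h1 _ _ (by simpa using hj.1) hj.2)]
      simp

open Polynomial in
theorem det_vandermonde_eq_det_block {d : ℕ} (z : Fin N → F) (χ : Fin N → Bool)
    (hχ : (Finset.univ.filter fun i => χ i = false).card = d) :
    (Matrix.vandermonde z).det = (Matrix.of fun i j : Fin N => if (j : ℕ) < d then z i ^ (j : ℕ)
      else (∏ a ∈ Finset.univ.filter fun i => χ i = false, (z i - z a)) *
        z i ^ ((j : ℕ) - d)).det := by
  set q : F[X] := ∏ a ∈ Finset.univ.filter fun i => χ i = false, (X - C (z a)) with hq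
  have hqm : q.Monic := monic_prod_of_monic _ _ fun a _ => monic_X_sub_C _
  have hqd : q.natDegree = d := by
    rw [hq, natDegree_prod_of_monic _ _ fun a _ => monic_X_sub_C _]
    simp [hχ]
  rw [Matrix.det_eval_matrixOfPolynomials_eq_det_vandermonde z
    (fun j : Fin N => if (j : ℕ) < d then X ^ (j : ℕ) else q * X ^ ((j : ℕ) - d))]
  · congr 1
    ext i j
    simp only [Matrix.of_apply]
    split_ifs
    · simp
    · simp [hq, eval_prod]
  · intro j
    split_ifs with h
    · simp
    · rw [hqm.natDegree_mul (monic_X_pow _), hqd, natDegree_X_pow]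
      omega
  · intro j
    split_ifs with h
    · exact monic_X_pow _
    · exact hqm.mul (monic_X_pow _)

theorem det_twoBlockAlternant {d e : ℕ} (hd : d ≤ N) (z : Fin N → F)
    (hz : Function.Injective z) :
    (twoBlockAlternant d e z).det = (Matrix.vandermonde z).det *
      ∑ χ : Fin N → Bool, if (Finset.univ.filter fun i => χ i = true).card = N - d then
        subsetWeight e z χ else 0 := by
  set g : Fin N → Bool → Fin N → F := fun i b j =>
    if b then (if (j : ℕ) < d then 0 else z i ^ (e + ((j : ℕ) - d)))
    else (if (j : ℕ) < d then z i ^ (j : ℕ) else 0) with hg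
  have hrow : twoBlockAlternant d e z = fun i => ∑ b : Bool, g i b := by
    ext i j
    simp only [twoBlockAlternant, Matrix.of_apply, Fintype.sum_bool, Pi.add_apply, hg]
    by_cases h : (j : ℕ) < d <;> simp [h]
  have hsum : (twoBlockAlternant d e z).det =
      ∑ χ : Fin N → Bool, Matrix.det (Matrix.of fun i => g i (χ i)) := by
    rw [hrow]
    exact (Matrix.detRowAlternating (R := F) (n := Fin N)).toMultilinearMap.map_sum g
  have hcard : ∀ χ : Fin N → Bool, (Finset.univ.filter fun i => χ i = true).card = N - d ↔
      (Finset.univ.filter fun i => χ i = false).card = d := by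
    intro χ
    have := Finset.card_filter_add_card_filter_not (s := Finset.univ) (fun i => χ i = true)
    simp only [Bool.not_eq_true, Finset.card_univ, Fintype.card_fin] at this
    omega
  rw [hsum, Finset.mul_sum]
  refine Finset.sum_congr rfl fun χ _ => ?_
  simp only [hcard]
  split_ifs with h
  · set p : Fin N → F := fun i => ∏ a ∈ Finset.univ.filter fun i => χ i = false, (z i - z a)
    have hp : ∀ i, χ i = true → p i ≠ 0 := by
      intro i hi
      refine Finset.prod_ne_zero_iff.mpr fun a ha => sub_ne_zero.mpr fun hh => ?_
      have := hz hh
      subst this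
      simp [hi] at ha
    rw [det_eq_prod_mul_det_of_block χ h hd (fun i => if χ i then z i ^ e * (p i)⁻¹ else 1) _
      (Matrix.of fun i j : Fin N => if (j : ℕ) < d then z i ^ (j : ℕ) else p i * z i ^ ((j : ℕ) - d)),
      ← det_vandermonde_eq_det_block z χ h, mul_comm]
    · congr 1
      rw [subsetWeight, ← Finset.prod_mul_distrib]
      refine Finset.prod_congr rfl fun i _ => ?_
      split_ifs with hi
      · congr 1
        simp only [p]
        rw [Finset.prod_filter, ← Finset.prod_inv_distrib]
        refine Finset.prod_congr rfl fun a _ => ?_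
        by_cases ha : χ a = true
        · simp [ha]
        · simp [hi, ha]
      · simp [hi]
    · intro i j hi hj
      have hj' : ¬ (j : ℕ) < d := not_lt.mpr hj
      refine ⟨by simp [hg, hi, hj'], ?_⟩
      simp only [Matrix.of_apply, hj', if_false]
      have : p i = 0 := Finset.prod_eq_zero (i := i) (by simp [hi]) (by simp)
      rw [this, zero_mul]
    · intro i j hi hj
      simp [hg, hi, hj]
    · intro i j hi hj
      have hj' : ¬ (j : ℕ) < d := not_lt.mpr hj
      have := hp i hi
      simp only [hg, hi, hj', Matrix.of_apply, if_true, if_false, pow_add]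
      field_simp
  · rw [mul_zero]
    refine det_eq_zero_of_block χ h hd _ ?_ ?_
    · intro i j hi hj
      simp [hg, hi, not_lt.mpr hj]
    · intro i j hi hj
      simp [hg, hi, hj]

end Laplace

section SymmetricVariables

/-- The variables `y, x_1, x_1⁻¹, …, x_k, x_k⁻¹`. -/
def symVars {k : ℕ} (x : Fin k → F) (y : F) : Option (Fin k × Bool) → F
  | none => y
  | some (i, true) => x i
  | some (i, false) => (x i)⁻¹

/-- The product of the elements of the subset of `{x, x⁻¹}` described by `c`. -/
def choiceMon (c : Bool × Bool) (x : F) : F :=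
  (if c.1 then x else 1) * (if c.2 then x⁻¹ else 1)

/-- The product of `(b - a)⁻¹` over `b` in the subset of `{x, x⁻¹}` described by `c` and `a` in
the complement of the subset of `{x', x'⁻¹}` described by `c'`. -/
def crossWeight (c c' : Bool × Bool) (x x' : F) : F :=
  ((if c.1 ∧ ¬ c'.1 then (x - x')⁻¹ else 1) * (if c.1 ∧ ¬ c'.2 then (x - x'⁻¹)⁻¹ else 1)) *
  ((if c.2 ∧ ¬ c'.1 then (x⁻¹ - x')⁻¹ else 1) * (if c.2 ∧ ¬ c'.2 then (x⁻¹ - x'⁻¹)⁻¹ else 1))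

/-- The analogue of `crossWeight` between `y` and a subset of `{x, x⁻¹}`. -/
def crossWeightY (b : Bool) (c : Bool × Bool) (x y : F) : F :=
  if b then (if ¬ c.1 then (y - x)⁻¹ else 1) * (if ¬ c.2 then (y - x⁻¹)⁻¹ else 1)
  else (if c.1 then (x - y)⁻¹ else 1) * (if c.2 then (x⁻¹ - y)⁻¹ else 1)

/-- The weight `subsetWeight` of a subset of the variables `symVars`. -/
def choiceWeight {k : ℕ} (e : ℕ) (x : Fin k → F) (y : F) (b : Bool) (χ : Fin k → Bool × Bool) : F :=
  ((if b then y else 1) * ∏ i, choiceMon (χ i) (x i)) ^ e *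
    ((∏ i, crossWeightY b (χ i) (x i) y) * ∏ i, ∏ j, crossWeight (χ i) (χ j) (x i) (x j))

/-- The cardinality of a subset of the variables `symVars`. -/
def choiceCard {k : ℕ} (b : Bool) (χ : Fin k → Bool × Bool) : ℕ :=
  b.toNat + ∑ i, ((χ i).1.toNat + (χ i).2.toNat)

/-- The Laplace expansion of the Schur function of shape `(m^k)`, where `e = m + k + 1`, in the
variables `symVars`. -/
def rectSum {k : ℕ} (e : ℕ) (x : Fin k → F) (y : F) : F :=
  ∑ b : Bool, ∑ χ : Fin k → Bool × Bool,
    if choiceCard b χ = k then choiceWeight e x y b χ else 0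

/-- Subsets of the variables `symVars`, in terms of subsets of each `{x_i, x_i⁻¹}`. -/
def choiceEquiv (k : ℕ) : (Option (Fin k × Bool) → Bool) ≃ Bool × (Fin k → Bool × Bool) where
  toFun f := (f none, fun i => (f (some (i, true)), f (some (i, false))))
  invFun p
    | none => p.1
    | some (i, true) => (p.2 i).1
    | some (i, false) => (p.2 i).2
  left_inv f := by
    ext o
    rcases o with _ | ⟨i, _ | _⟩ <;> rfl
  right_inv p := rfl

theorem card_filter_eq_choiceCard {k : ℕ} (f : Option (Fin k × Bool) → Bool) :
    (Finset.univ.filter fun o => f o = true).card =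
      choiceCard (choiceEquiv k f).1 (choiceEquiv k f).2 := by
  rw [Finset.card_filter, choiceCard, Fintype.sum_option, Fintype.sum_prod_type]
  simp only [Fintype.sum_bool, choiceEquiv, Equiv.coe_fn_mk, Bool.toNat, Bool.cond_eq_ite]

theorem subsetWeight_symVars {k : ℕ} (e : ℕ) (x : Fin k → F) (y : F)
    (f : Option (Fin k × Bool) → Bool) :
    subsetWeight e (symVars x y) f =
      choiceWeight e x y (choiceEquiv k f).1 (choiceEquiv k f).2 := by
  have hite : ∀ (p : Prop) [Decidable p] (u : F), (if p then u ^ e else 1) =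
      (if p then u else 1) ^ e := by
    intro p _ u
    split_ifs <;> simp
  simp only [subsetWeight, choiceWeight, Fintype.prod_option, Fintype.prod_prod_type,
    Fintype.prod_bool, hite, choiceEquiv, Equiv.coe_fn_mk, symVars]
  simp only [mul_pow, ← Finset.prod_pow, choiceMon]
  congr 1
  simp only [crossWeight, crossWeightY]
  cases f none
  · simp only [Bool.false_eq_true, if_false, not_false_iff, and_true,
      false_and, one_mul, Finset.prod_const_one, Finset.prod_mul_distrib]
    ring
  · simp only [if_true, if_false, not_true, and_false, true_and, one_mul,
      Finset.prod_mul_distrib]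

theorem det_twoBlockAlternant_symVars {k N : ℕ} (hN : N = 2 * k + 1) (e : ℕ) (x : Fin k → F) (y : F)
    (φ : Option (Fin k × Bool) ≃ Fin N) (z : Fin N → F) (hz : Function.Injective z)
    (hzφ : ∀ o, z (φ o) = symVars x y o) :
    (twoBlockAlternant (k + 1) e z).det = (Matrix.vandermonde z).det * rectSum e x y := by
  rw [det_twoBlockAlternant (by omega) z hz, rectSum, ← Fintype.sum_prod_type']
  congr 1
  refine Fintype.sum_equiv ((φ.symm.arrowCongr (Equiv.refl Bool)).trans (choiceEquiv k)) _ _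
    fun f => ?_
  have hf : φ.symm.arrowCongr (Equiv.refl Bool) f = f ∘ φ := by
    ext o
    simp
  have h1 : (Finset.univ.filter fun i => f i = true).card =
      (Finset.univ.filter fun o => (f ∘ φ) o = true).card := by
    rw [Finset.card_filter, Finset.card_filter]
    exact (Equiv.sum_comp φ fun i => if f i = true then 1 else 0).symm
  have h2 : subsetWeight e z f = subsetWeight e (symVars x y) (f ∘ φ) := by
    simp only [subsetWeight, ← hzφ, Function.comp]
    congr 1
    · exact (Equiv.prod_comp φ fun i => if f i = true then z i ^ e else 1).symm
    · rw [← Equiv.prod_comp φ]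
      refine Finset.prod_congr rfl fun i _ => ?_
      rw [← Equiv.prod_comp φ]
  rw [h1, h2, card_filter_eq_choiceCard, subsetWeight_symVars, Equiv.trans_apply, hf]
  have : N - (k + 1) = k := by omega
  rw [this]

/-- Genericity of the variables `x_1, …, x_k, y`: the variables `symVars` are distinct. -/
structure GenericVars {k : ℕ} (x : Fin k → F) (y : F) : Prop where
  ne_zero : ∀ i, x i ≠ 0
  sq_ne_one : ∀ i, x i ^ 2 ≠ 1
  ne : ∀ i j, i ≠ j → x i ≠ x j
  mul_ne_one : ∀ i j, i ≠ j → x i * x j ≠ 1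
  ne_last : ∀ i, x i ≠ y
  mul_last_ne_one : ∀ i, x i * y ≠ 1

theorem GenericVars.comp {k l : ℕ} {x : Fin k → F} {y : F} (h : GenericVars x y)
    {g : Fin l → Fin k} (hg : Function.Injective g) : GenericVars (x ∘ g) y where
  ne_zero _ := h.ne_zero _
  sq_ne_one _ := h.sq_ne_one _
  ne _ _ hij := h.ne _ _ (hg.ne hij)
  mul_ne_one _ _ hij := h.mul_ne_one _ _ (hg.ne hij)
  ne_last _ := h.ne_last _
  mul_last_ne_one _ := h.mul_last_ne_one _

theorem GenericVars.injective_symVars {k : ℕ} {x : Fin k → F} {y : F} (h : GenericVars x y) :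
    Function.Injective (symVars x y) := by
  have hinv : ∀ i j, x i ≠ (x j)⁻¹ := by
    intro i j hij
    have hj := h.ne_zero j
    have h1 : x i * x j = 1 := by rw [hij, inv_mul_cancel₀ hj]
    by_cases hc : i = j
    · subst hc
      exact h.sq_ne_one i (by rw [sq, h1])
    · exact h.mul_ne_one i j hc h1
  have hy : ∀ i, (x i)⁻¹ ≠ y := by
    intro i hi
    exact h.mul_last_ne_one i (by rw [← hi, mul_inv_cancel₀ (h.ne_zero i)])
  have hx : ∀ i j, x i = x j → i = j := fun i j hij => by
    by_contra hc
    exact h.ne i j hc hij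
  rintro (_ | ⟨i, _ | _⟩) (_ | ⟨j, _ | _⟩) hij <;> simp only [symVars] at hij
  · rfl
  · exact absurd hij.symm (hy j)
  · exact absurd hij.symm (h.ne_last j)
  · exact absurd hij (hy i)
  · rw [hx i j (inv_injective hij)]
  · exact absurd hij.symm (hinv j i)
  · exact absurd hij (h.ne_last i)
  · exact absurd hij (hinv i j)
  · rw [hx i j hij]

theorem rectSum_self_eq_zero {k : ℕ} {x : Fin k → F} {y : F} (h : GenericVars x y) (hk : 0 < k) :
    rectSum k x y = 0 := by
  have hcard : Fintype.card (Option (Fin k × Bool)) = 2 * k + 1 := by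
    simp [mul_comm]
  set φ : Option (Fin k × Bool) ≃ Fin (2 * k + 1) := Fintype.equivFinOfCardEq hcard
  have hz : Function.Injective (symVars x y ∘ φ.symm) :=
    h.injective_symVars.comp φ.symm.injective
  have hdet := det_twoBlockAlternant_symVars rfl k x y φ _ hz (by simp)
  have h0 : (twoBlockAlternant (k + 1) k (symVars x y ∘ φ.symm)).det = 0 := by
    refine Matrix.det_zero_of_column_eq (i := ⟨k, by omega⟩) (j := ⟨k + 1, by omega⟩)
      (by simp) fun i => ?_
    simp [twoBlockAlternant]
  rw [h0] at hdet
  exact (mul_eq_zero.mp hdet.symm).resolve_left (Matrix.det_vandermonde_ne_zero_iff.mpr hz)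

end SymmetricVariables

section Recursion

/-- The element of the subset of `{x, x⁻¹}` described by `c`, when this is a singleton. -/
def singleVal (c : Bool × Bool) (x : F) : F := if c.1 then x else x⁻¹

/-- The factor comparing the cross weights between `z` and a subset of `{x, x⁻¹}` to a difference
of the `x + x⁻¹`. -/
def crossRatio (z : F) (c : Bool × Bool) (x : F) : F :=
  if c.1 ≠ c.2 then (z * singleVal c x - 1) / (z - singleVal c x) else if c.1 then z⁻¹ else z

/-- The factor `z - y` or `y - z⁻¹`, according to whether `y` belongs to the subset or not. -/
def lastFactor (b : Bool) (z y : F) : F := if b then y - z⁻¹ else z - y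

theorem singleVal_sub_ne_zero {x x' : F} (hx : x ≠ 0) (hx' : x' ≠ 0) (h1 : x ≠ x')
    (h2 : x * x' ≠ 1) (c c' : Bool × Bool) : singleVal c x - singleVal c' x' ≠ 0 := by
  have h1' : x⁻¹ ≠ x'⁻¹ := fun h => h1 (inv_injective h)
  have h2' : x ≠ x'⁻¹ := fun h => h2 (by rw [h, inv_mul_cancel₀ hx'])
  have h3' : x⁻¹ ≠ x' := fun h => h2 (by rw [← h, mul_inv_cancel₀ hx])
  rw [sub_ne_zero]
  simp only [singleVal]
  split_ifs <;> assumption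

theorem crossWeight_mul_crossRatio {x x' : F} (hx : x ≠ 0) (hx' : x' ≠ 0) (h1 : x ≠ x')
    (h2 : x * x' ≠ 1) (c c' : Bool × Bool) (hc : c.1 ≠ c.2) :
    crossWeight c c' x x' * crossWeight c' c x' x * crossRatio (singleVal c x) c' x' =
      (x + x⁻¹ - (x' + x'⁻¹))⁻¹ := by
  have d1 : x - x' ≠ 0 := sub_ne_zero.mpr h1
  have d1' : x' - x ≠ 0 := sub_ne_zero.mpr h1.symm
  have d2 : x * x' - 1 ≠ 0 := sub_ne_zero.mpr h2
  have e1 : x⁻¹ - x'⁻¹ = (x' - x) / (x * x') := by field_simp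
  have e1' : x'⁻¹ - x⁻¹ = (x - x') / (x * x') := by field_simp
  have e2 : x - x'⁻¹ = (x * x' - 1) / x' := by field_simp
  have e2' : x'⁻¹ - x = - (x * x' - 1) / x' := by field_simp; ring
  have e3 : x⁻¹ - x' = - (x * x' - 1) / x := by field_simp; ring
  have e3' : x' - x⁻¹ = (x * x' - 1) / x := by field_simp
  have e4 : x + x⁻¹ - (x' + x'⁻¹) = (x - x') * (x * x' - 1) / (x * x') := by field_simp; ring
  have e5 : x⁻¹ * x' - 1 = (x' - x) / x := by field_simp
  have e6 : x * x'⁻¹ - 1 = (x - x') / x' := by field_simp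
  have e7 : x⁻¹ * x'⁻¹ - 1 = - (x * x' - 1) / (x * x') := by field_simp; ring
  obtain ⟨p, q⟩ := c
  obtain ⟨p', q'⟩ := c'
  rw [e4]
  cases p <;> cases q <;> cases p' <;> cases q' <;>
    simp [crossWeight, crossRatio, singleVal, e1, e1', e2, e2', e3, e3', e5, e6, e7] at hc ⊢ <;>
    first
      | (field_simp; done)
      | (field_simp; ring1)
      | (rw [← neg_sub (x * x') 1, ← neg_sub x x']; field_simp)

theorem crossWeight_self {x : F} (c : Bool × Bool) (hc : c.1 ≠ c.2) :
    crossWeight c c x x = (singleVal c x - (singleVal c x)⁻¹)⁻¹ := by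
  obtain ⟨p, q⟩ := c
  cases p <;> cases q <;> simp [crossWeight, singleVal] at hc ⊢

theorem crossWeightY_mul_lastFactor {x y : F} (hx : x ≠ 0) (h1 : x ≠ y) (h2 : x * y ≠ 1) (b : Bool)
    (c : Bool × Bool) (hc : c.1 ≠ c.2) :
    crossWeightY b c x y * lastFactor b (singleVal c x) y = 1 := by
  have d1 : x - y ≠ 0 := sub_ne_zero.mpr h1
  have d1' : y - x ≠ 0 := sub_ne_zero.mpr h1.symm
  have d2 : y - x⁻¹ ≠ 0 := sub_ne_zero.mpr fun h => h2 (by rw [h, mul_inv_cancel₀ hx])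
  have d2' : x⁻¹ - y ≠ 0 := sub_ne_zero.mpr fun h => h2 (by rw [← h, mul_inv_cancel₀ hx])
  obtain ⟨p, q⟩ := c
  cases b <;> cases p <;> cases q <;>
    simp [crossWeightY, lastFactor, singleVal, d1, d1', d2, d2'] at hc ⊢

theorem prod_succAbove_eq_prod_erase {k : ℕ} (j : Fin (k + 1)) (f : Fin (k + 1) → F) :
    ∏ i, f (j.succAbove i) = ∏ i ∈ Finset.univ.erase j, f i := by
  rw [Fin.univ_succAbove k j, Finset.erase_cons, Finset.prod_map]
  rfl

variable {k : ℕ}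

/-- Removing a singleton choice at `j` from a weight. -/
theorem choiceWeight_mul_prod_crossRatio {x : Fin (k + 1) → F} {y : F} (h : GenericVars x y) (e : ℕ)
    (b : Bool) (χ : Fin (k + 1) → Bool × Bool) (j : Fin (k + 1)) (hj : (χ j).1 ≠ (χ j).2) :
    choiceWeight e x y b χ * (lastFactor b (singleVal (χ j) (x j)) y *
        ∏ i, crossRatio (singleVal (χ j) (x j)) (χ (j.succAbove i)) (x (j.succAbove i))) =
      singleVal (χ j) (x j) ^ e * (singleVal (χ j) (x j) - (singleVal (χ j) (x j))⁻¹)⁻¹ *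
        (∏ i, (x j + (x j)⁻¹ - (x (j.succAbove i) + (x (j.succAbove i))⁻¹))⁻¹) *
        choiceWeight e (x ∘ j.succAbove) y b (χ ∘ j.succAbove) := by
  have hmon : choiceMon (χ j) (x j) = singleVal (χ j) (x j) := by
    rcases hc : χ j with ⟨_ | _, _ | _⟩ <;> simp [hc, choiceMon, singleVal] at hj ⊢
  have hprod : ∏ i, (x j + (x j)⁻¹ - (x (j.succAbove i) + (x (j.succAbove i))⁻¹))⁻¹ =
      (∏ i, crossWeight (χ j) (χ (j.succAbove i)) (x j) (x (j.succAbove i))) *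
      (∏ i, crossWeight (χ (j.succAbove i)) (χ j) (x (j.succAbove i)) (x j)) *
      ∏ i, crossRatio (singleVal (χ j) (x j)) (χ (j.succAbove i)) (x (j.succAbove i)) := by
    rw [← Finset.prod_mul_distrib, ← Finset.prod_mul_distrib]
    refine Finset.prod_congr rfl fun i _ => ?_
    rw [crossWeight_mul_crossRatio (h.ne_zero _) (h.ne_zero _)
      (h.ne _ _ (Fin.ne_succAbove j i)) (h.mul_ne_one _ _ (Fin.ne_succAbove j i)) _ _ hj]
  rw [hprod]
  simp only [choiceWeight, Fin.prod_univ_succAbove _ j, Finset.prod_mul_distrib, hmon,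
    crossWeight_self (χ j) hj, Function.comp]
  have hY := crossWeightY_mul_lastFactor (h.ne_zero j) (h.ne_last j) (h.mul_last_ne_one j) b (χ j) hj
  set z := singleVal (χ j) (x j)
  generalize (∏ i, crossWeight (χ j) (χ (j.succAbove i)) (x j) (x (j.succAbove i))) = P1
  generalize (∏ i, crossWeight (χ (j.succAbove i)) (χ j) (x (j.succAbove i)) (x j)) = P2
  generalize (∏ i, crossRatio z (χ (j.succAbove i)) (x (j.succAbove i))) = P3
  generalize (∏ i, choiceMon (χ (j.succAbove i)) (x (j.succAbove i))) = P4
  generalize (∏ i, crossWeightY b (χ (j.succAbove i)) (x (j.succAbove i)) y) = P5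
  rw [show ∀ u v : F, u * (z * v) = z * (u * v) from fun u v => by ring, mul_pow]
  linear_combination (P1 * P2 * P3 * P5 * z ^ e * (z - z⁻¹)⁻¹ *
    ((if b = true then y else 1) * P4) ^ e *
    ∏ i, ∏ i', crossWeight (χ (j.succAbove i)) (χ (j.succAbove i')) (x (j.succAbove i))
      (x (j.succAbove i'))) * hY

theorem prod_choiceMon {x : Fin k → F} (hx : ∀ i, x i ≠ 0) (χ : Fin k → Bool × Bool) :
    ∏ i, choiceMon (χ i) (x i) =
      ∏ i ∈ Finset.univ.filter fun i => (χ i).1 ≠ (χ i).2, singleVal (χ i) (x i) := by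
  rw [Finset.prod_filter]
  refine Finset.prod_congr rfl fun i _ => ?_
  rcases χ i with ⟨_ | _, _ | _⟩ <;> simp [choiceMon, singleVal, hx i]

/-- The constant by which the even and odd cases of the recursion differ. -/
def recCoeff (k : ℕ) (y : F) : F := if Even k then 1 else y

theorem lastFactor_mul_prod_crossRatio {x : Fin (k + 1) → F} (hx : ∀ i, x i ≠ 0) (y : F)
    (b : Bool) (χ : Fin (k + 1) → Bool × Bool) (hχ : choiceCard b χ = k + 1) (j : Fin (k + 1))
    (hj : (χ j).1 ≠ (χ j).2) :
    lastFactor b (singleVal (χ j) (x j)) y *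
        ∏ i, crossRatio (singleVal (χ j) (x j)) (χ (j.succAbove i)) (x (j.succAbove i)) =
      ((if b then y else 1) * singleVal (χ j) (x j) + (if b then -1 else -y)) *
        ∏ i ∈ (Finset.univ.filter fun i => (χ i).1 ≠ (χ i).2).erase j,
          (singleVal (χ j) (x j) * singleVal (χ i) (x i) - 1) /
            (singleVal (χ j) (x j) - singleVal (χ i) (x i)) := by
  set z := singleVal (χ j) (x j) with hz
  have hz0 : z ≠ 0 := by
    rw [hz, singleVal]
    split_ifs
    · exact hx j
    · exact inv_ne_zero (hx j)
  have hsplit : ∀ i, crossRatio z (χ i) (x i) =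
      (if (χ i).1 ≠ (χ i).2 then (z * singleVal (χ i) (x i) - 1) / (z - singleVal (χ i) (x i)) else 1) *
      ((if χ i = (false, false) then z else 1) * (if χ i = (true, true) then z⁻¹ else 1)) := by
    intro i
    rcases χ i with ⟨_ | _, _ | _⟩ <;> simp [crossRatio]
  have hff : ∏ i ∈ Finset.univ.erase j, (if χ i = (false, false) then z else 1) =
      z ^ (Finset.univ.filter fun i => χ i = (false, false)).card := by
    rw [Finset.prod_erase, Finset.prod_ite, Finset.prod_const, Finset.prod_const_one, mul_one]
    rw [if_neg]
    intro hc
    simp [hc] at hj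
  have htt : ∏ i ∈ Finset.univ.erase j, (if χ i = (true, true) then z⁻¹ else 1) =
      z⁻¹ ^ (Finset.univ.filter fun i => χ i = (true, true)).card := by
    rw [Finset.prod_erase, Finset.prod_ite, Finset.prod_const, Finset.prod_const_one, mul_one]
    rw [if_neg]
    intro hc
    simp [hc] at hj
  have hcount : (Finset.univ.filter fun i => χ i = (false, false)).card =
      (Finset.univ.filter fun i => χ i = (true, true)).card + b.toNat := by
    have hsum : (∑ i, ((χ i).1.toNat + (χ i).2.toNat)) +
        (Finset.univ.filter fun i => χ i = (false, false)).card =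
        (∑ _i : Fin (k + 1), 1) + (Finset.univ.filter fun i => χ i = (true, true)).card := by
      rw [Finset.card_filter, Finset.card_filter, ← Finset.sum_add_distrib,
        ← Finset.sum_add_distrib]
      refine Finset.sum_congr rfl fun i _ => ?_
      rcases χ i with ⟨_ | _, _ | _⟩ <;> simp
    rw [choiceCard] at hχ
    simp only [Finset.sum_const, Finset.card_univ, Fintype.card_fin, smul_eq_mul, mul_one] at hsum
    omega
  rw [prod_succAbove_eq_prod_erase j fun i => crossRatio z (χ i) (x i)]
  simp only [hsplit]
  rw [Finset.prod_mul_distrib, Finset.prod_mul_distrib, hff, htt, hcount, ← Finset.prod_filter,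
    ← Finset.filter_erase, pow_add, inv_pow]
  have hpow : z ^ (Finset.univ.filter fun i => χ i = (true, true)).card ≠ 0 := pow_ne_zero _ hz0
  cases b <;> simp only [lastFactor, Bool.toNat_true, Bool.toNat_false, if_true, if_false,
    Bool.false_eq_true] <;> field_simp <;> ring

/-- The scalar identity behind the recursion for `rectSum`. -/
theorem mon_sub_recCoeff (h2 : (2 : F) ≠ 0) {x : Fin (k + 1) → F} {y : F} (h : GenericVars x y)
    (b : Bool) (χ : Fin (k + 1) → Bool × Bool) (hχ : choiceCard b χ = k + 1) :
    ((if b then y else 1) * ∏ i, choiceMon (χ i) (x i)) - recCoeff (k + 1) y =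
      ∑ j, if (χ j).1 ≠ (χ j).2 then lastFactor b (singleVal (χ j) (x j)) y *
        ∏ i, crossRatio (singleVal (χ j) (x j)) (χ (j.succAbove i)) (x (j.succAbove i)) else 0 := by
  set T := Finset.univ.filter fun i => (χ i).1 ≠ (χ i).2 with hT
  set zv : Fin (k + 1) → F := fun i => singleVal (χ i) (x i) with hzv
  have hinj : Function.Injective zv := by
    intro i j hij
    by_contra hc
    exact singleVal_sub_ne_zero (h.ne_zero i) (h.ne_zero j) (h.ne i j hc) (h.mul_ne_one i j hc)
      (χ i) (χ j) (sub_eq_zero.mpr hij)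
  have hsq : ∀ z ∈ T.image zv, z ^ 2 ≠ 1 := by
    intro z hz
    obtain ⟨i, -, rfl⟩ := Finset.mem_image.mp hz
    simp only [hzv, singleVal]
    split_ifs
    · exact h.sq_ne_one i
    · rw [inv_pow]
      exact fun hc => h.sq_ne_one i (inv_eq_one.mp hc)
  have key := sum_linear_mul_prod_div h2 (T.image zv) hsq (if b then y else 1)
    (if b then -1 else -y)
  rw [Finset.sum_image hinj.injOn, Finset.prod_image hinj.injOn,
    Finset.card_image_of_injective _ hinj] at key
  have hpar : b.toNat + (T.card + 2 * (Finset.univ.filter fun i => χ i = (true, true)).card) =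
      k + 1 := by
    refine Eq.trans ?_ hχ
    rw [choiceCard, hT, Finset.card_filter, Finset.card_filter, Finset.mul_sum,
      ← Finset.sum_add_distrib]
    congr 1
    refine Finset.sum_congr rfl fun i _ => ?_
    rcases χ i with ⟨_ | _, _ | _⟩ <;> simp
  rw [prod_choiceMon h.ne_zero, ← Finset.sum_filter]
  rw [Finset.sum_congr rfl fun j hj => lastFactor_mul_prod_crossRatio h.ne_zero y b χ hχ j
    (Finset.mem_filter.mp hj).2]
  have himg : ∀ j ∈ T, ∏ w ∈ (T.image zv).erase (zv j), (zv j * w - 1) / (zv j - w) =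
      ∏ i ∈ T.erase j, (zv j * zv i - 1) / (zv j - zv i) := by
    intro j _
    rw [← Finset.image_erase hinj, Finset.prod_image hinj.injOn]
  rw [Finset.sum_congr rfl fun j hj => by rw [himg j hj]] at key
  refine Eq.trans ?_ key.symm
  congr 1
  rw [recCoeff, eq_div_iff h2]
  rcases Nat.even_or_odd T.card with hev | hodd
  · rw [hev.neg_one_pow]
    cases b
    · rw [if_pos]
      · simp; ring
      · rw [← hpar]; simpa using hev.add (even_two_mul _)
    · rw [if_neg]
      · simp; ring
      · rw [← hpar, Nat.not_even_iff_odd]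
        simpa using odd_one.add_even (hev.add (even_two_mul _))
  · rw [hodd.neg_one_pow]
    cases b
    · rw [if_neg]
      · simp; ring
      · rw [← hpar, Nat.not_even_iff_odd]; simpa using hodd.add_even (even_two_mul _)
    · rw [if_pos]
      · simp; ring
      · rw [← hpar]
        simpa using odd_one.add_odd (hodd.add_even (even_two_mul _))

theorem choiceCard_insertNth (b : Bool) (j : Fin (k + 1)) (c : Bool × Bool)
    (χ : Fin k → Bool × Bool) :
    choiceCard b (j.insertNth c χ : Fin (k + 1) → Bool × Bool) =
      choiceCard b χ + (c.1.toNat + c.2.toNat) := by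
  simp only [choiceCard, Fin.sum_univ_succAbove _ j, Fin.insertNth_apply_same,
    Fin.insertNth_apply_succAbove]
  ring

/-- One summand of the recursion, as a sum over subsets that contain exactly one of
`x_j` and `x_j⁻¹`. -/
theorem sub_mul_rectSum_succAbove {x : Fin (k + 1) → F} {y : F} (h : GenericVars x y) (e : ℕ)
    (j : Fin (k + 1)) :
    (x j ^ e - (x j)⁻¹ ^ e) * ((x j - (x j)⁻¹)⁻¹ *
      ∏ i, (x j + (x j)⁻¹ - (x (j.succAbove i) + (x (j.succAbove i))⁻¹))⁻¹) *
      rectSum e (x ∘ j.succAbove) y =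
    ∑ b : Bool, ∑ χ : Fin (k + 1) → Bool × Bool, if choiceCard b χ = k + 1 then
      (if (χ j).1 ≠ (χ j).2 then choiceWeight e x y b χ * (lastFactor b (singleVal (χ j) (x j)) y *
        ∏ i, crossRatio (singleVal (χ j) (x j)) (χ (j.succAbove i)) (x (j.succAbove i))) else 0)
      else 0 := by
  rw [rectSum, Finset.mul_sum]
  refine Finset.sum_congr rfl fun b _ => ?_
  rw [← (Fin.insertNthEquiv (fun _ => Bool × Bool) j).sum_comp, Fintype.sum_prod_type,
    Finset.sum_comm, Finset.mul_sum]
  refine Finset.sum_congr rfl fun χ _ => ?_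
  have hterm : ∀ c : Bool × Bool, c.1 ≠ c.2 →
      choiceWeight e x y b (j.insertNth c χ : Fin (k + 1) → Bool × Bool) *
        (lastFactor b (singleVal c (x j)) y *
          ∏ i, crossRatio (singleVal c (x j)) (χ i) (x (j.succAbove i))) =
      singleVal c (x j) ^ e * (singleVal c (x j) - (singleVal c (x j))⁻¹)⁻¹ *
        (∏ i, (x j + (x j)⁻¹ - (x (j.succAbove i) + (x (j.succAbove i))⁻¹))⁻¹) *
        choiceWeight e (x ∘ j.succAbove) y b χ := by
    intro c hc
    have := choiceWeight_mul_prod_crossRatio h e b (j.insertNth c χ : Fin (k + 1) → Bool × Bool) j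
      (by simpa using hc)
    simp only [Fin.insertNth_apply_same, Fin.insertNth_apply_succAbove] at this
    rw [this]
    congr 2
    ext i : 1
    simp
  have hequiv : ∀ c : Bool × Bool, Fin.insertNthEquiv (fun _ => Bool × Bool) j (c, χ) =
      (j.insertNth c χ : Fin (k + 1) → Bool × Bool) := fun _ => rfl
  have hneg : ((x j)⁻¹ - x j)⁻¹ = -(x j - (x j)⁻¹)⁻¹ := by rw [← neg_sub, inv_neg]
  simp only [hequiv, choiceCard_insertNth, Fin.insertNth_apply_same,
    Fin.insertNth_apply_succAbove, Fintype.sum_prod_type, Fintype.sum_bool]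
  rw [if_neg (by simp : ¬ (((true, true) : Bool × Bool).1 ≠ ((true, true) : Bool × Bool).2)),
    if_neg (by simp : ¬ (((false, false) : Bool × Bool).1 ≠ ((false, false) : Bool × Bool).2)),
    if_pos (by simp : (((true, false) : Bool × Bool).1 ≠ ((true, false) : Bool × Bool).2)),
    if_pos (by simp : (((false, true) : Bool × Bool).1 ≠ ((false, true) : Bool × Bool).2)),
    hterm _ (by simp), hterm _ (by simp)]
  simp only [singleVal, if_true, Bool.false_eq_true, if_false, inv_inv, hneg, Bool.toNat_true,
    Bool.toNat_false, ite_self, zero_add, add_zero, Nat.add_right_cancel_iff]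
  split_ifs <;> ring

theorem rectSum_succ_sub (h2 : (2 : F) ≠ 0) {x : Fin (k + 1) → F} {y : F} (h : GenericVars x y)
    (e : ℕ) :
    rectSum (e + 1) x y - recCoeff (k + 1) y * rectSum e x y =
      ∑ j, (x j ^ e - (x j)⁻¹ ^ e) * ((x j - (x j)⁻¹)⁻¹ *
        ∏ i, (x j + (x j)⁻¹ - (x (j.succAbove i) + (x (j.succAbove i))⁻¹))⁻¹) *
        rectSum e (x ∘ j.succAbove) y := by
  simp only [sub_mul_rectSum_succAbove h]
  rw [Finset.sum_comm, rectSum, rectSum, Finset.mul_sum, ← Finset.sum_sub_distrib]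
  refine Finset.sum_congr rfl fun b _ => ?_
  rw [Finset.sum_comm, Finset.mul_sum, ← Finset.sum_sub_distrib]
  refine Finset.sum_congr rfl fun χ _ => ?_
  split_ifs with hχ
  · have key := mon_sub_recCoeff h2 h b χ hχ
    have hsucc : choiceWeight (e + 1) x y b χ =
        ((if b then y else 1) * ∏ i, choiceMon (χ i) (x i)) * choiceWeight e x y b χ := by
      rw [choiceWeight, choiceWeight, pow_succ]
      ring
    rw [hsucc, ← sub_mul, key, Finset.sum_mul]
    refine Finset.sum_congr rfl fun j _ => ?_
    split_ifs
    · ring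
    · rw [zero_mul]
  · simp

end Recursion

section ColumnPartitions

/-- The partitions with at most `k` parts and largest part at most `m`, all of whose columns have
length congruent to `k` modulo `2`. -/
def parityPartitions : (k : ℕ) → ℕ → Finset (Fin k → ℕ)
  | 0, _ => {Fin.elim0}
  | k + 1, m =>
    if Even k then (parityPartitions k m).image (Fin.cons m)
    else (Finset.range (m + 1)).biUnion fun p => (parityPartitions k p).image (Fin.cons p)

theorem mem_parityPartitions_succ {k m : ℕ} {μ : Fin (k + 1) → ℕ} :
    μ ∈ parityPartitions (k + 1) m ↔
      (if Even k then μ 0 = m else μ 0 ≤ m) ∧ Fin.tail μ ∈ parityPartitions k (μ 0) := by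
  have hcons : ∀ p, (∃ ν ∈ parityPartitions k p, (Fin.cons p ν : Fin (k + 1) → ℕ) = μ) ↔
      μ 0 = p ∧ Fin.tail μ ∈ parityPartitions k (μ 0) := by
    intro p
    constructor
    · rintro ⟨ν, hν, rfl⟩
      simpa using hν
    · rintro ⟨rfl, hμ⟩
      exact ⟨_, hμ, Fin.cons_self_tail μ⟩
  rw [parityPartitions]
  split_ifs with hk
  · rw [Finset.mem_image, hcons]
  · simp only [Finset.mem_biUnion, Finset.mem_image, hcons, Finset.mem_range, Nat.lt_succ_iff]
    constructor
    · rintro ⟨p, hp, rfl, hμ⟩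
      exact ⟨hp, hμ⟩
    · rintro ⟨hp, hμ⟩
      exact ⟨_, hp, rfl, hμ⟩

theorem antitone_fin_succ_iff {k : ℕ} {μ : Fin (k + 1) → ℕ} :
    Antitone μ ↔ (∀ i, Fin.tail μ i ≤ μ 0) ∧ Antitone (Fin.tail μ) := by
  constructor
  · intro h
    exact ⟨fun i => h (Fin.zero_le _), fun i j hij => h (Fin.succ_le_succ_iff.mpr hij)⟩
  · rintro ⟨h0, h⟩ i j
    refine Fin.cases ?_ (fun i => ?_) i <;> refine Fin.cases ?_ (fun j => ?_) j <;> intro hij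
    · exact le_rfl
    · exact h0 j
    · simp at hij
    · exact h (Fin.succ_le_succ_iff.mp hij)

theorem card_filter_le_fin_succ {k : ℕ} (μ : Fin (k + 1) → ℕ) (c : ℕ) :
    (Finset.univ.filter fun j => c ≤ μ j).card =
      (if c ≤ μ 0 then 1 else 0) + (Finset.univ.filter fun j => c ≤ Fin.tail μ j).card := by
  rw [Finset.card_filter, Finset.card_filter, Fin.sum_univ_succ]
  rfl

theorem mem_parityPartitions {k m : ℕ} {μ : Fin k → ℕ} :
    μ ∈ parityPartitions k m ↔ Antitone μ ∧ (∀ i, μ i ≤ m) ∧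
      ∀ c, 1 ≤ c → c ≤ m → (Finset.univ.filter fun j => c ≤ μ j).card % 2 = k % 2 := by
  induction k generalizing m with
  | zero =>
    simp only [parityPartitions, Finset.mem_singleton, Subsingleton.elim μ Fin.elim0, true_iff]
    exact ⟨fun i => i.elim0, fun i => i.elim0, fun c _ _ => by simp⟩
  | succ k ih =>
    rw [mem_parityPartitions_succ, ih, antitone_fin_succ_iff, Fin.forall_fin_succ]
    simp only [card_filter_le_fin_succ]
    change _ ↔ _ ∧ (_ ∧ ∀ i, Fin.tail μ i ≤ m) ∧ _
    constructor
    · rintro ⟨h0, hanti, hle, hcol⟩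
      have h0m : μ 0 ≤ m := by
        split_ifs at h0 <;> omega
      refine ⟨⟨hle, hanti⟩, ⟨h0m, fun i => (hle i).trans h0m⟩, fun c hc hcm => ?_⟩
      by_cases hc0 : c ≤ μ 0
      · rw [if_pos hc0, Nat.add_mod, hcol c hc hc0, ← Nat.add_mod, add_comm]
      · have hk : ¬ Even k := by
          intro hk
          rw [if_pos hk] at h0
          omega
        rw [if_neg hc0, Finset.card_eq_zero.mpr]
        · rw [Nat.not_even_iff] at hk
          omega
        · refine Finset.filter_eq_empty_iff.mpr fun i _ hi => hc0 (hi.trans (hle i))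
    · rintro ⟨⟨hle, hanti⟩, ⟨h0m, hm⟩, hcol⟩
      refine ⟨?_, hanti, hle, fun c hc hc0 => ?_⟩
      · split_ifs with hk
        · by_contra hne
          have := hcol m (by omega) le_rfl
          rw [if_neg (by omega), Finset.card_eq_zero.mpr] at this
          · rw [Nat.even_iff] at hk
            omega
          · refine Finset.filter_eq_empty_iff.mpr fun i _ hi => ?_
            have := hle i
            omega
        · exact h0m
      · have := hcol c hc (hc0.trans h0m)
        rw [if_pos hc0] at this
        omega

theorem parityPartitions_zero_right (k : ℕ) : parityPartitions k 0 = {fun _ => 0} := by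
  ext μ
  rw [mem_parityPartitions, Finset.mem_singleton]
  constructor
  · rintro ⟨-, h, -⟩
    exact funext fun i => Nat.le_zero.mp (h i)
  · rintro rfl
    exact ⟨antitone_const, fun _ => le_rfl, fun c hc hc' => by omega⟩

theorem sum_parityPartitions_succ_of_even {k : ℕ} (hk : Even k) (m : ℕ) (f : (Fin (k + 1) → ℕ) → F) :
    ∑ μ ∈ parityPartitions (k + 1) m, f μ = ∑ ν ∈ parityPartitions k m, f (Fin.cons m ν) := by
  rw [parityPartitions, if_pos hk, Finset.sum_image (Fin.cons_right_injective (α := fun _ => ℕ) m).injOn]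

theorem sum_parityPartitions_succ_of_not_even {k : ℕ} (hk : ¬ Even k) (m : ℕ)
    (f : (Fin (k + 1) → ℕ) → F) :
    ∑ μ ∈ parityPartitions (k + 1) m, f μ =
      ∑ p ∈ Finset.range (m + 1), ∑ ν ∈ parityPartitions k p, f (Fin.cons p ν) := by
  rw [parityPartitions, if_neg hk, Finset.sum_biUnion]
  · refine Finset.sum_congr rfl fun p _ => ?_
    rw [Finset.sum_image (Fin.cons_right_injective (α := fun _ => ℕ) p).injOn]
  · intro p _ q _ hpq
    refine Finset.disjoint_left.mpr fun μ hp hq => hpq ?_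
    obtain ⟨ν, -, rfl⟩ := Finset.mem_image.mp hp
    obtain ⟨ν', -, h⟩ := Finset.mem_image.mp hq
    simpa using (congrFun h 0).symm

/-- The skew-symmetric functions `U_p(x)` with `U_{p+1} = y U_p + (x^{p+1} - x^{-p-1})`. -/
def oddGeom (y : F) : ℕ → F → F
  | 0, _ => 0
  | p + 1, x => y * oddGeom y p x + (x ^ (p + 1) - x⁻¹ ^ (p + 1))

/-- The determinant of the functions `oddGeom` attached to `μ`. -/
def partDet {k : ℕ} (x : Fin k → F) (y : F) (μ : Fin k → ℕ) : F :=
  Matrix.det (Matrix.of fun i j => oddGeom y (μ i + (k - i)) (x j))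

/-- The determinant `partDet` with an additional first row. -/
def borderedDet {k : ℕ} (x : Fin (k + 1) → F) (y : F) (v : F → F) (ν : Fin k → ℕ) : F :=
  Matrix.det (Matrix.of fun i j =>
    (Fin.cons (v (x j)) fun i : Fin k => oddGeom y (ν i + (k - i)) (x j) : Fin (k + 1) → F) i)

variable {k : ℕ}

theorem borderedDet_eq_sum (x : Fin (k + 1) → F) (y : F) (v : F → F) (ν : Fin k → ℕ) :
    borderedDet x y v ν = ∑ j : Fin (k + 1), (-1) ^ (j : ℕ) * v (x j) * partDet (x ∘ j.succAbove) y ν := by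
  rw [borderedDet, Matrix.det_succ_row_zero]
  rfl

theorem partDet_cons (x : Fin (k + 1) → F) (y : F) (p : ℕ) (ν : Fin k → ℕ) :
    partDet x y (Fin.cons p ν) = borderedDet x y (oddGeom y (p + k + 1)) ν := by
  rw [partDet, borderedDet]
  congr 1
  ext i j
  refine Fin.cases ?_ (fun i => ?_) i
  · simp [add_assoc]
  · simp

theorem borderedDet_oddGeom_succ (x : Fin (k + 1) → F) (y : F) (p : ℕ) (ν : Fin k → ℕ) :
    borderedDet x y (oddGeom y (p + 1)) ν = y * borderedDet x y (oddGeom y p) ν +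
      borderedDet x y (fun u => u ^ (p + 1) - u⁻¹ ^ (p + 1)) ν := by
  simp only [borderedDet_eq_sum, oddGeom, Finset.mul_sum, ← Finset.sum_add_distrib]
  exact Finset.sum_congr rfl fun j _ => by ring

theorem borderedDet_oddGeom_cons (x : Fin (k + 2) → F) (y : F) (p : ℕ) (ν : Fin k → ℕ) :
    borderedDet x y (oddGeom y (p + (k + 1))) (Fin.cons p ν) = 0 :=
  Matrix.det_zero_of_row_eq (i := 0) (j := 1) (by simp) (by ext j; rfl)

/-- The sum of `partDet` over all `parityPartitions`. -/
def partSum (m : ℕ) (x : Fin k → F) (y : F) : F :=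
  ∑ μ ∈ parityPartitions k m, partDet x y μ

theorem sum_borderedDet (m : ℕ) (x : Fin (k + 1) → F) (y : F) (v : F → F) :
    ∑ ν ∈ parityPartitions k m, borderedDet x y v ν =
      ∑ j : Fin (k + 1), (-1) ^ (j : ℕ) * v (x j) * partSum m (x ∘ j.succAbove) y := by
  simp only [borderedDet_eq_sum, partSum, Finset.mul_sum]
  exact Finset.sum_comm

theorem partSum_succ_of_even (hk : Even k) (m : ℕ) (x : Fin (k + 1) → F) (y : F) :
    partSum m x y = ∑ ν ∈ parityPartitions k m, borderedDet x y (oddGeom y (m + k + 1)) ν := by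
  simp only [partSum, sum_parityPartitions_succ_of_even hk, partDet_cons]

theorem partSum_succ_of_not_even (hk : ¬ Even k) (m : ℕ) (x : Fin (k + 1) → F) (y : F) :
    partSum m x y = ∑ p ∈ Finset.range (m + 1), ∑ ν ∈ parityPartitions k p,
      borderedDet x y (oddGeom y (p + k + 1)) ν := by
  simp only [partSum, sum_parityPartitions_succ_of_not_even hk, partDet_cons]

theorem sum_borderedDet_oddGeom_of_even (hk : Even k) (m : ℕ) (x : Fin (k + 1) → F) (y : F) :
    ∑ ν ∈ parityPartitions k m, borderedDet x y (oddGeom y (m + k)) ν =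
      if m = 0 then 0 else partSum (m - 1) x y := by
  rcases k with _ | k
  · rcases m with _ | m
    · simp [borderedDet_eq_sum, oddGeom]
    · simp [partSum_succ_of_even hk, parityPartitions]
  · have hk' : ¬ Even k := by
      rwa [Nat.even_add_one] at hk
    rw [sum_parityPartitions_succ_of_not_even hk', Finset.sum_range_succ]
    simp only [borderedDet_oddGeom_cons, Finset.sum_const_zero, add_zero]
    rcases m with _ | m
    · simp
    · rw [if_neg (Nat.succ_ne_zero m), Nat.add_sub_cancel, partSum_succ_of_even hk,
        sum_parityPartitions_succ_of_not_even hk', show m + (k + 1) + 1 = m + 1 + (k + 1) by ring]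

theorem sum_borderedDet_oddGeom_of_not_even (hk : ¬ Even k) (m : ℕ) (x : Fin (k + 1) → F) (y : F) :
    ∑ ν ∈ parityPartitions k m, borderedDet x y (oddGeom y (m + k)) ν = 0 := by
  rcases k with _ | k
  · simp at hk
  · have hk' : Even k := by
      rwa [Nat.even_add_one, not_not] at hk
    simp only [sum_parityPartitions_succ_of_even hk', borderedDet_oddGeom_cons,
      Finset.sum_const_zero]

theorem partSum_recursion (m : ℕ) (x : Fin (k + 1) → F) (y : F) :
    partSum m x y = (∑ j : Fin (k + 1), (-1) ^ (j : ℕ) * (x j ^ (m + k + 1) - (x j)⁻¹ ^ (m + k + 1)) *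
        partSum m (x ∘ j.succAbove) y) +
      recCoeff (k + 1) y * if m = 0 then 0 else partSum (m - 1) x y := by
  rw [← sum_borderedDet m x y fun u => u ^ (m + k + 1) - u⁻¹ ^ (m + k + 1)]
  by_cases hk : Even k
  · rw [recCoeff, if_neg (by rwa [Nat.even_add_one, not_not]),
      ← sum_borderedDet_oddGeom_of_even hk, partSum_succ_of_even hk]
    simp only [borderedDet_oddGeom_succ, Finset.sum_add_distrib, Finset.mul_sum]
    ring
  · have hp : ∀ p, ∑ ν ∈ parityPartitions k p, borderedDet x y (oddGeom y (p + k + 1)) ν =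
        ∑ ν ∈ parityPartitions k p,
          borderedDet x y (fun u => u ^ (p + k + 1) - u⁻¹ ^ (p + k + 1)) ν := by
      intro p
      simp only [borderedDet_oddGeom_succ, Finset.sum_add_distrib, ← Finset.mul_sum]
      rw [sum_borderedDet_oddGeom_of_not_even hk, mul_zero, zero_add]
    rw [recCoeff, if_pos (by rwa [Nat.even_add_one]), partSum_succ_of_not_even hk,
      Finset.sum_range_succ, hp m, one_mul, add_comm]
    congr 1
    rcases m with _ | m
    · simp
    · rw [if_neg (Nat.succ_ne_zero m), Nat.add_sub_cancel, partSum_succ_of_not_even hk]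

end ColumnPartitions

section Evaluation

/-- The denominator of the symplectic characters, as a product. -/
def oddVandermonde {k : ℕ} (x : Fin k → F) : F :=
  (∏ i, (x i - (x i)⁻¹)) *
    ∏ i, ∏ j, if i < j then x i + (x i)⁻¹ - (x j + (x j)⁻¹) else 1

variable {k : ℕ}

theorem GenericVars.sub_inv_ne_zero {x : Fin k → F} {y : F} (h : GenericVars x y) (i : Fin k) :
    x i - (x i)⁻¹ ≠ 0 := by
  intro hc
  refine h.sq_ne_one i ?_
  rw [sub_eq_zero] at hc
  rw [sq]
  nth_rw 2 [hc]
  exact mul_inv_cancel₀ (h.ne_zero i)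

theorem GenericVars.add_inv_sub_ne_zero {x : Fin k → F} {y : F} (h : GenericVars x y)
    {i j : Fin k} (hij : i ≠ j) : x i + (x i)⁻¹ - (x j + (x j)⁻¹) ≠ 0 := by
  have hi := h.ne_zero i
  have hj := h.ne_zero j
  have : x i + (x i)⁻¹ - (x j + (x j)⁻¹) = (x i - x j) * (x i * x j - 1) * ((x i)⁻¹ * (x j)⁻¹) := by
    field_simp
    ring
  rw [this]
  exact mul_ne_zero (mul_ne_zero (sub_ne_zero.mpr (h.ne i j hij))
    (sub_ne_zero.mpr (h.mul_ne_one i j hij))) (mul_ne_zero (inv_ne_zero hi) (inv_ne_zero hj))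

theorem GenericVars.oddVandermonde_ne_zero {x : Fin k → F} {y : F} (h : GenericVars x y) :
    oddVandermonde x ≠ 0 := by
  refine mul_ne_zero (Finset.prod_ne_zero_iff.mpr fun i _ => h.sub_inv_ne_zero i)
    (Finset.prod_ne_zero_iff.mpr fun i _ => Finset.prod_ne_zero_iff.mpr fun j _ => ?_)
  split_ifs with hij
  · exact h.add_inv_sub_ne_zero hij.ne
  · exact one_ne_zero

theorem prod_ite_succAbove_lt (j : Fin (k + 1)) :
    ∏ i, (if j.succAbove i < j then (-1 : F) else 1) = (-1) ^ (j : ℕ) := by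
  rw [Finset.prod_ite, Finset.prod_const, Finset.prod_const_one, mul_one]
  congr 1
  simp only [Fin.succAbove_lt_iff_castSucc_lt]
  simp only [Fin.lt_def, Fin.val_castSucc]
  rw [Fin.card_filter_val_lt]
  omega

theorem oddVandermonde_succAbove (x : Fin (k + 1) → F) (j : Fin (k + 1)) :
    oddVandermonde x = (-1) ^ (j : ℕ) * (x j - (x j)⁻¹) *
      (∏ i, (x j + (x j)⁻¹ - (x (j.succAbove i) + (x (j.succAbove i))⁻¹))) *
      oddVandermonde (x ∘ j.succAbove) := by
  have hsign : (-1) ^ (j : ℕ) *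
      ∏ i, (x j + (x j)⁻¹ - (x (j.succAbove i) + (x (j.succAbove i))⁻¹)) =
      (∏ i, if j < j.succAbove i then
        x j + (x j)⁻¹ - (x (j.succAbove i) + (x (j.succAbove i))⁻¹) else 1) *
      ∏ i, if j.succAbove i < j then
        x (j.succAbove i) + (x (j.succAbove i))⁻¹ - (x j + (x j)⁻¹) else 1 := by
    rw [← prod_ite_succAbove_lt, ← Finset.prod_mul_distrib, ← Finset.prod_mul_distrib]
    refine Finset.prod_congr rfl fun i _ => ?_
    rcases (Fin.succAbove_ne j i).lt_or_gt with hij | hij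
    · rw [if_pos hij, if_neg hij.not_gt, if_pos hij]
      ring
    · rw [if_neg hij.not_gt, if_pos hij, if_neg hij.not_gt]
      ring
  simp only [oddVandermonde, Fin.prod_univ_succAbove _ j, Finset.prod_mul_distrib, lt_irrefl,
    if_false, (Fin.strictMono_succAbove j).lt_iff_lt, Function.comp]
  linear_combination -((x j - (x j)⁻¹) * (∏ i, (x (j.succAbove i) - (x (j.succAbove i))⁻¹)) *
    ∏ i, ∏ i', if i < i' then x (j.succAbove i) + (x (j.succAbove i))⁻¹ -
      (x (j.succAbove i') + (x (j.succAbove i'))⁻¹) else 1) * hsign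

theorem oddVandermonde_mul_inv {x : Fin (k + 1) → F} {y : F} (h : GenericVars x y)
    (j : Fin (k + 1)) :
    oddVandermonde x * ((x j - (x j)⁻¹)⁻¹ *
      ∏ i, (x j + (x j)⁻¹ - (x (j.succAbove i) + (x (j.succAbove i))⁻¹))⁻¹) =
      (-1) ^ (j : ℕ) * oddVandermonde (x ∘ j.succAbove) := by
  have h1 := h.sub_inv_ne_zero j
  have h2 : ∏ i, (x j + (x j)⁻¹ - (x (j.succAbove i) + (x (j.succAbove i))⁻¹)) ≠ 0 :=
    Finset.prod_ne_zero_iff.mpr fun i _ => h.add_inv_sub_ne_zero (Fin.succAbove_ne j i).symm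
  rw [oddVandermonde_succAbove x j, Finset.prod_inv_distrib]
  generalize ∏ i, (x j + (x j)⁻¹ - (x (j.succAbove i) + (x (j.succAbove i))⁻¹)) = P at h2
  generalize x j - (x j)⁻¹ = s at h1
  field_simp

theorem partSum_eq (h2 : (2 : F) ≠ 0) (m : ℕ) {x : Fin k → F} {y : F} (h : GenericVars x y) :
    partSum m x y = oddVandermonde x * rectSum (m + k + 1) x y := by
  induction k generalizing m with
  | zero =>
    simp [partSum, parityPartitions, partDet, oddVandermonde, rectSum, choiceCard, choiceWeight]
  | succ k ihk =>
    have key : ∀ m, partSum m x y = oddVandermonde x * rectSum (m + (k + 1) + 1) x y +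
        recCoeff (k + 1) y * ((if m = 0 then 0 else partSum (m - 1) x y) -
          oddVandermonde x * rectSum (m + k + 1) x y) := by
      intro m
      have hrec := rectSum_succ_sub h2 h (m + k + 1)
      have hsum : ∑ j : Fin (k + 1), (-1) ^ (j : ℕ) * (x j ^ (m + k + 1) - (x j)⁻¹ ^ (m + k + 1)) *
          partSum m (x ∘ j.succAbove) y = oddVandermonde x * (rectSum (m + k + 1 + 1) x y -
          recCoeff (k + 1) y * rectSum (m + k + 1) x y) := by
        rw [hrec, Finset.mul_sum]
        refine Finset.sum_congr rfl fun j _ => ?_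
        rw [ihk m (h.comp (Fin.succAbove_right_injective))]
        linear_combination -((x j ^ (m + k + 1) - (x j)⁻¹ ^ (m + k + 1)) *
          rectSum (m + k + 1) (x ∘ j.succAbove) y) * oddVandermonde_mul_inv h j
      rw [partSum_recursion, hsum, ← add_assoc m k 1]
      ring
    induction m with
    | zero =>
      rw [key, if_pos rfl, zero_add k, rectSum_self_eq_zero h (Nat.succ_pos k)]
      ring
    | succ m ihm =>
      rw [key, if_neg (Nat.succ_ne_zero m), Nat.add_sub_cancel, ihm,
        show m + 1 + k + 1 = m + (k + 1) + 1 by ring]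
      ring

end Evaluation

section Characters

variable {k : ℕ}

theorem oddGeom_mul (x y : F) (hx : x ≠ 0) (p : ℕ) :
    (1 - x * y) * (1 - x⁻¹ * y) * oddGeom y p x =
      (x ^ p - x⁻¹ ^ p) - y * (x ^ (p + 1) - x⁻¹ ^ (p + 1)) + y ^ (p + 1) * (x - x⁻¹) := by
  induction p with
  | zero => simp [oddGeom]
  | succ p ih =>
    have hxx : x * x⁻¹ = 1 := mul_inv_cancel₀ hx
    rw [oddGeom]
    linear_combination y * ih + (y ^ 2 * (x ^ (p + 1) - x⁻¹ ^ (p + 1)) +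
      y * (x⁻¹ ^ p - x ^ p)) * hxx

theorem oddGeom_eq {x y : F} (hx : x ≠ 0) (h1 : 1 - x * y ≠ 0) (h2 : 1 - x⁻¹ * y ≠ 0) (p : ℕ) :
    x ^ p / (1 - x⁻¹ * y) - x⁻¹ ^ p / (1 - x * y) =
      oddGeom y p x + y ^ p * (1 / (1 - x⁻¹ * y) - 1 / (1 - x * y)) := by
  have key := oddGeom_mul x y hx p
  generalize x⁻¹ = w at *
  rw [div_sub_div _ _ h2 h1, div_sub_div _ _ h2 h1, ← mul_div_assoc, ← sub_eq_iff_eq_add,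
    ← sub_div, div_eq_iff (mul_ne_zero h2 h1)]
  linear_combination -key

theorem filter_le_val_eq_last : (Finset.univ.filter fun l : Fin (k + 1) => k ≤ (l : ℕ)) =
    {Fin.last k} := by
  ext l
  simp only [Finset.mem_filter, Finset.mem_univ, true_and, Finset.mem_singleton, Fin.ext_iff,
    Fin.val_last]
  omega

/-- The bialternant of an intermediate symplectic character for a partition with at most `k` parts
as a determinant of order `k`. -/
theorem det_interMatP {z : Fin (k + 1) → F} (h0 : ∀ i : Fin k, z i.castSucc ≠ 0)
    (h : ∀ i : Fin k, z i.castSucc ≠ z (Fin.last k))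
    (h' : ∀ i : Fin k, z i.castSucc * z (Fin.last k) ≠ 1)
    (μ : Fin (k + 1) → ℤ) (ν : Fin k → ℕ) (hμ : ∀ i : Fin k, μ i.castSucc = ν i)
    (hlast : μ (Fin.last k) = 0) :
    (interMatP k z μ).det = partDet (fun i => z i.castSucc) (z (Fin.last k)) ν := by
  set y := z (Fin.last k) with hy
  set B : Matrix (Fin (k + 1)) (Fin (k + 1)) F := Matrix.of fun i j =>
    Fin.lastCases (interMatP k z μ (Fin.last k) j)
      (fun i => Fin.lastCases 0 (fun j => oddGeom y (ν i + (k - i)) (z j.castSucc)) j) i with hB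
  have hexp : ∀ i : Fin k, μ i.castSucc + (k : ℤ) - ((i.castSucc : Fin (k + 1)) : ℕ) =
      ((ν i + (k - i) : ℕ) : ℤ) := by
    intro i
    rw [hμ, Fin.val_castSucc]
    have := i.isLt
    omega
  have hcast : ∀ (i : Fin (k + 1)) (j : Fin k), interMatP k z μ i j.castSucc =
      z j.castSucc ^ (μ i + (k : ℤ) - (i : ℕ)) / (1 - (z j.castSucc)⁻¹ * y) -
        z j.castSucc ^ (-(μ i + (k : ℤ) - (i : ℕ))) / (1 - z j.castSucc * y) := by
    intro i j
    rw [interMatP, Matrix.of_apply, if_pos (by simp), filter_le_val_eq_last,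
      Finset.prod_singleton, Finset.prod_singleton]
  have hcol : ∀ i : Fin (k + 1), interMatP k z μ i (Fin.last k) =
      y ^ (μ i + (k : ℤ) - (i : ℕ)) := by
    intro i
    rw [interMatP, Matrix.of_apply, if_neg (by simp)]
    congr 1
    push_cast
    ring
  have hdet : (interMatP k z μ).det = B.det := by
    refine Matrix.det_eq_of_forall_row_eq_smul_add_const
      (Fin.lastCases 0 fun i => y ^ (ν i + (k - i))) (Fin.last k) (by simp) fun i j => ?_
    refine Fin.lastCases ?_ (fun i => ?_) i
    · simp [hB]
    · refine Fin.lastCases ?_ (fun j => ?_) j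
      · simp only [hB, Matrix.of_apply, Fin.lastCases_castSucc, Fin.lastCases_last, hcol, hexp,
          hlast, Fin.val_last, zpow_natCast]
        simp
      · have h1 : 1 - z j.castSucc * y ≠ 0 := sub_ne_zero.mpr (h' j).symm
        have h2 : 1 - (z j.castSucc)⁻¹ * y ≠ 0 := by
          refine sub_ne_zero.mpr fun hc => h j ?_
          field_simp [h0 j] at hc
          exact hc
        have := oddGeom_eq (h0 j) h1 h2 (ν i + (k - i))
        simp only [hB, Matrix.of_apply, Fin.lastCases_castSucc, Fin.lastCases_last, hcast, hexp,
          hlast, Fin.val_last, zpow_natCast, _root_.zpow_neg]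
        simpa using this
  have hBlast : ∀ i : Fin k, B i.castSucc (Fin.last k) = 0 := by
    intro i
    simp [hB]
  have hBcorner : B (Fin.last k) (Fin.last k) = 1 := by
    simp [hB, hcol, hlast]
  rw [hdet, Matrix.det_succ_column B (Fin.last k), Fin.sum_univ_castSucc]
  simp only [hBlast, hBcorner, mul_zero, zero_mul, Finset.sum_const_zero, zero_add, Fin.val_last,
    mul_one]
  rw [Even.neg_one_pow ⟨k, rfl⟩, one_mul, partDet]
  congr 1
  ext i j
  simp [hB]

theorem det_alternant_eq {N : ℕ} (d e : ℕ) (z : Fin N → F) (μ : Fin N → ℤ)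
    (hμ : ∀ i : Fin N, μ i + (N : ℤ) - 1 - (i : ℕ) =
      ((if (i.rev : ℕ) < d then (i.rev : ℕ) else e + (i.rev - d) : ℕ) : ℤ)) :
    Matrix.det (Matrix.of fun i j : Fin N => z j ^ (μ i + (N : ℤ) - 1 - (i : ℕ))) =
      (Equiv.Perm.sign (Fin.revPerm : Equiv.Perm (Fin N)) : F) *
        (twoBlockAlternant d e z).det := by
  rw [← Matrix.det_transpose (twoBlockAlternant d e z), ← Matrix.det_permute]
  congr 1
  ext i j
  simp only [Matrix.of_apply, hμ, Matrix.submatrix_apply, Matrix.transpose_apply,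
    twoBlockAlternant, id, Fin.revPerm_apply, zpow_natCast]
  split_ifs <;> rfl

theorem twoBlockAlternant_self {N : ℕ} (d : ℕ) (z : Fin N → F) :
    twoBlockAlternant d d z = Matrix.vandermonde z := by
  ext i j
  simp only [twoBlockAlternant, Matrix.of_apply, Matrix.vandermonde_apply]
  split_ifs with h
  · rfl
  · rw [Nat.add_sub_cancel' (not_lt.mp h)]

theorem rectSum_succ_self {x : Fin k → F} {y : F} (h : GenericVars x y) :
    rectSum (k + 1) x y = 1 := by
  have hcard : Fintype.card (Option (Fin k × Bool)) = 2 * k + 1 := by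
    simp [mul_comm]
  set φ : Option (Fin k × Bool) ≃ Fin (2 * k + 1) := Fintype.equivFinOfCardEq hcard
  have hz : Function.Injective (symVars x y ∘ φ.symm) :=
    h.injective_symVars.comp φ.symm.injective
  have hdet := det_twoBlockAlternant_symVars rfl (k + 1) x y φ _ hz (by simp)
  rw [twoBlockAlternant_self] at hdet
  exact mul_left_cancel₀ (Matrix.det_vandermonde_ne_zero_iff.mpr hz)
    (hdet.symm.trans (mul_one _).symm)

theorem schurP_rectangle {N : ℕ} (hN : N = 2 * k + 1) {x : Fin k → F} {y : F}
    (h : GenericVars x y) (φ : Option (Fin k × Bool) ≃ Fin N) (z : Fin N → F)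
    (hzφ : ∀ o, z (φ o) = symVars x y o) (m : ℕ) :
    schurP z (fun i => if (i : ℕ) < k then (m : ℤ) else 0) = rectSum (m + k + 1) x y := by
  have hz : Function.Injective z := by
    have : z = symVars x y ∘ φ.symm := by
      ext i
      simp [← hzφ]
    rw [this]
    exact h.injective_symVars.comp φ.symm.injective
  have hnum := det_alternant_eq (k + 1) (m + k + 1) z (fun i => if (i : ℕ) < k then (m : ℤ) else 0)
    fun i => by
      have := i.isLt
      rw [Fin.val_rev]
      split_ifs <;> omega
  have hden := det_alternant_eq (k + 1) (k + 1) z (fun _ => 0) fun i => by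
    have := i.isLt
    rw [Fin.val_rev]
    split_ifs <;> omega
  simp only [zero_add] at hden
  have hs : ((Equiv.Perm.sign (Fin.revPerm : Equiv.Perm (Fin N)) : ℤ) : F) ≠ 0 := by
    rcases Int.units_eq_one_or (Equiv.Perm.sign (Fin.revPerm : Equiv.Perm (Fin N))) with h | h <;>
      simp [h]
  rw [schurP, hnum, hden, twoBlockAlternant_self, det_twoBlockAlternant_symVars hN _ x y φ z hz hzφ,
    mul_div_mul_left _ _ hs, mul_div_cancel_left₀ _ (Matrix.det_vandermonde_ne_zero_iff.mpr hz)]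

theorem sum_spInterP {z : Fin (k + 1) → F} (h2 : (2 : F) ≠ 0) {x : Fin k → F} {y : F}
    (h : GenericVars x y) (hx : ∀ i, z (Fin.castSucc i) = x i) (hy : z (Fin.last k) = y) {m : ℕ}
    (hm : 0 < m) (s : Finset (Fin (k + 1) → Fin (m + 1)))
    (hs : ∀ lam, lam ∈ s ↔ (Antitone fun i => (lam i : ℕ)) ∧ ∀ c : ℕ, 1 ≤ c → c ≤ m →
      (Finset.univ.filter fun j : Fin (k + 1) => c ≤ (lam j : ℕ)).card % 2 = k % 2) :
    ∑ lam ∈ s, spInterP k z (fun i => ((lam i : ℕ) : ℤ)) = rectSum (m + k + 1) x y := by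
  obtain rfl : (fun i : Fin k => z i.castSucc) = x := funext hx
  subst hy
  have hdet : ∀ (μ : Fin (k + 1) → ℤ) (ν : Fin k → ℕ), (∀ i : Fin k, μ i.castSucc = ν i) →
      μ (Fin.last k) = 0 →
      (interMatP k z μ).det = partDet (fun i => z i.castSucc) (z (Fin.last k)) ν :=
    fun μ ν => det_interMatP h.ne_zero h.ne_last h.mul_last_ne_one μ ν
  have hcard : ∀ (lam : Fin (k + 1) → Fin (m + 1)) (c : ℕ),
      (Finset.univ.filter fun j : Fin (k + 1) => c ≤ (lam j : ℕ)).card =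
      (Finset.univ.filter fun j : Fin k => c ≤ (lam j.castSucc : ℕ)).card +
        if c ≤ (lam (Fin.last k) : ℕ) then 1 else 0 := by
    intro lam c
    rw [Finset.card_filter, Finset.card_filter, Fin.sum_univ_castSucc]
  have hlast : ∀ lam ∈ s, (lam (Fin.last k) : ℕ) = 0 := by
    intro lam hlam
    obtain ⟨hanti, hcol⟩ := (hs lam).mp hlam
    by_contra hne
    have h1 := hcol 1 le_rfl hm
    rw [Finset.filter_true_of_mem, Finset.card_univ, Fintype.card_fin] at h1
    · omega
    · intro j _
      exact (Nat.one_le_iff_ne_zero.mpr hne).trans (hanti (Fin.le_last j))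
  have hden : (interMatP k z fun _ => 0).det = oddVandermonde fun i => z i.castSucc := by
    have := partSum_eq h2 0 h
    rw [partSum, parityPartitions_zero_right, Finset.sum_singleton, zero_add,
      rectSum_succ_self h, mul_one] at this
    rw [← this]
    exact hdet _ _ (fun _ => rfl) rfl
  have hsum : ∑ lam ∈ s, (interMatP k z fun i => ((lam i : ℕ) : ℤ)).det =
      partSum m (fun i => z i.castSucc) (z (Fin.last k)) := by
    rw [partSum]
    refine Finset.sum_bij' (fun lam _ i => (lam i.castSucc : ℕ))
      (fun μ _ => Fin.lastCases 0 fun i => Fin.ofNat (m + 1) (μ i)) ?_ ?_ ?_ ?_ ?_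
    · intro lam hlam
      obtain ⟨hanti, hcol⟩ := (hs lam).mp hlam
      refine mem_parityPartitions.mpr ⟨fun i j hij => hanti (Fin.castSucc_le_castSucc_iff.mpr hij),
        fun i => Nat.le_of_lt_succ (lam _).isLt, fun c hc hcm => ?_⟩
      rw [← hcol c hc hcm, hcard, hlast lam hlam, if_neg (by omega), add_zero]
    · intro μ hμ
      obtain ⟨hanti, hle, hcol⟩ := mem_parityPartitions.mp hμ
      have hval : ∀ i, μ i % (m + 1) = μ i := fun i => Nat.mod_eq_of_lt (Nat.lt_succ_of_le (hle i))
      refine (hs _).mpr ⟨?_, fun c hc hcm => ?_⟩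
      · intro i j
        refine Fin.lastCases ?_ (fun j => ?_) j
        · simp
        · refine Fin.lastCases ?_ (fun i => ?_) i
          · intro hij
            exact absurd (Fin.castSucc_lt_last j) hij.not_gt
          · intro hij
            simpa [Fin.ofNat, hval] using hanti (Fin.castSucc_le_castSucc_iff.mp hij)
      · rw [hcard]
        simpa [Fin.ofNat, hval, Nat.one_le_iff_ne_zero.mp hc] using hcol c hc hcm
    · intro lam hlam
      ext i
      refine Fin.lastCases ?_ (fun i => ?_) i
      · simp [hlast lam hlam]
      · simp
    · intro μ hμ
      obtain ⟨-, hle, -⟩ := mem_parityPartitions.mp hμ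
      ext i
      simpa using hle i
    · intro lam hlam
      exact hdet _ _ (fun _ => rfl) (by simp [hlast lam hlam])
  simp only [spInterP]
  rw [← Finset.sum_div, hsum, hden, partSum_eq h2 m h,
    mul_div_cancel_left₀ _ h.oddVandermonde_ne_zero]

theorem gen_injective (n : ℕ) : Function.Injective (gen n) :=
  fun _ _ h => MvPolynomial.X_injective (IsFractionRing.injective _ _ h)

theorem gen_ne_zero {n : ℕ} (i : Fin n) : gen n i ≠ 0 := by
  rw [gen, ← map_zero (algebraMap (MvPolynomial (Fin n) ℚ) (FF n))]
  exact fun h => MvPolynomial.X_ne_zero i (IsFractionRing.injective _ _ h)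

theorem gen_mul_gen_ne_one {n : ℕ} (i j : Fin n) : gen n i * gen n j ≠ 1 := by
  rw [gen, gen, ← map_mul, ← map_one (algebraMap (MvPolynomial (Fin n) ℚ) (FF n))]
  intro h
  have := congrArg (MvPolynomial.eval 0)
    (IsFractionRing.injective (MvPolynomial (Fin n) ℚ) (FF n) h)
  simp at this

theorem genericVars_gen (k : ℕ) :
    GenericVars (fun i : Fin k => gen (k + 1) i.castSucc) (gen (k + 1) (Fin.last k)) where
  ne_zero _ := gen_ne_zero _
  sq_ne_one i := by
    rw [sq]
    exact gen_mul_gen_ne_one _ _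
  ne i j hij := (gen_injective _).ne ((Fin.castSucc_injective k).ne hij)
  mul_ne_one _ _ _ := gen_mul_gen_ne_one _ _
  ne_last i := (gen_injective _).ne (Fin.castSucc_lt_last i).ne
  mul_last_ne_one _ := gen_mul_gen_ne_one _ _

theorem schurP_gen (k m : ℕ) :
    schurP
      (fun j : Fin (2 * (k + 1) - 1) =>
        if (j : ℕ) % 2 = 0 then gen (k + 1) ⟨(j : ℕ) / 2, by have := j.isLt; omega⟩
        else (gen (k + 1) ⟨(j : ℕ) / 2, by have := j.isLt; omega⟩)⁻¹)
      (fun j => if (j : ℕ) < k then (m : ℤ) else 0) =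
    rectSum (m + k + 1) (fun i : Fin k => gen (k + 1) i.castSucc) (gen (k + 1) (Fin.last k)) := by
  set f : Option (Fin k × Bool) → Fin (2 * (k + 1) - 1) := fun o => match o with
    | none => ⟨2 * k, by omega⟩
    | some (i, true) => ⟨2 * i, by have := i.isLt; omega⟩
    | some (i, false) => ⟨2 * i + 1, by have := i.isLt; omega⟩ with hf
  have hinj : Function.Injective f := by
    rintro (_ | ⟨⟨i, hi⟩, _ | _⟩) (_ | ⟨⟨j, hj⟩, _ | _⟩) h <;>
      simp only [hf, Fin.mk.injEq, Option.some.injEq, Prod.mk.injEq, and_true, reduceCtorEq]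
        at h ⊢ <;> omega
  have hbij : Function.Bijective f := by
    rw [Fintype.bijective_iff_injective_and_card]
    refine ⟨hinj, ?_⟩
    simp
    omega
  refine schurP_rectangle (by omega) (genericVars_gen k) (Equiv.ofBijective f hbij) _ ?_ m
  rintro (_ | ⟨i, _ | _⟩)
  · simp [hf, symVars, Fin.last]
  · have h2 : (2 * (i : ℕ) + 1) / 2 = i := by omega
    simp [hf, symVars, h2, Fin.castSucc, Fin.castAdd, Fin.castLE]
  · simp [hf, symVars, Fin.castSucc, Fin.castAdd, Fin.castLE]

end Characters

/-- **Corollary.**  For `n ≥ 1` and a positive integer `m`, the Schur function of rectangular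
shape `(m^{n-1})` in the `2n-1` variables `(x_1, x_1^{-1}, …, x_{n-1}, x_{n-1}^{-1}, x_n)`
equals the sum of the intermediate symplectic characters `sp^{(n-1,1)}_λ(x_1,…,x_{n-1} | x_n)`
over all partitions `λ ⊆ (m^n)` all of whose column lengths are odd if `n` is even, and over all
those all of whose column lengths are even if `n` is odd; an identity in `ℚ(x_1, …, x_n)`.
Here `gen n i` plays the role of `x_i`, and the column length `λ′_c` is the number of indices
`j` with `λ_j ≥ c`. -/
theorem schur_rectangle'_eq_sum_spInter_columns (n m : ℕ) (hn : 1 ≤ n) (hm : 0 < m) :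
    schurP
      (fun j : Fin (2 * n - 1) =>
        if (j : ℕ) % 2 = 0 then gen n ⟨(j : ℕ) / 2, by have := j.isLt; omega⟩
        else (gen n ⟨(j : ℕ) / 2, by have := j.isLt; omega⟩)⁻¹)
      (fun j => if (j : ℕ) < n - 1 then (m : ℤ) else 0) =
    if Even n then
      ∑ lam ∈ Finset.univ.filter
          (fun lam : Fin n → Fin (m + 1) =>
            (Antitone fun i => (lam i : ℕ)) ∧
            ∀ c : ℕ, 1 ≤ c → c ≤ m →
              Odd (Finset.univ.filter (fun j : Fin n => c ≤ (lam j : ℕ))).card),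
        spInterP (n - 1) (gen n) (fun i => ((lam i : ℕ) : ℤ))
    else
      ∑ lam ∈ Finset.univ.filter
          (fun lam : Fin n → Fin (m + 1) =>
            (Antitone fun i => (lam i : ℕ)) ∧
            ∀ c : ℕ, 1 ≤ c → c ≤ m →
              Even (Finset.univ.filter (fun j : Fin n => c ≤ (lam j : ℕ))).card),
        spInterP (n - 1) (gen n) (fun i => ((lam i : ℕ) : ℤ)) := by
  obtain ⟨k, rfl⟩ : ∃ k, n = k + 1 := ⟨n - 1, by omega⟩
  have h2 : (2 : FF (k + 1)) ≠ 0 := two_ne_zero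
  simp only [Nat.add_sub_cancel]
  rw [schurP_gen]
  split_ifs with hk
  all_goals
    refine (sum_spInterP h2 (genericVars_gen k) (fun _ => rfl) rfl hm _ fun lam => ?_).symm
    rw [Finset.mem_filter]
    simp only [Finset.mem_univ, true_and]
  · rw [Nat.even_add_one, Nat.not_even_iff] at hk
    simp only [Nat.odd_iff, hk]
  · rw [Nat.even_add_one, not_not, Nat.even_iff] at hk
    simp only [Nat.even_iff, hk]
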